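/- For any spherical harmonic Y of degree ℓ on S^{n-1} and any function h : ℝ → ℂ continuous on [−1,1], there exists a scalar λ_h(ℓ) ∈ ℂ (independent of Y) such that ∫_{S^{n-1}} h(⟨ẋ, ẏ⟩) Y(ẏ) dσ(ẏ) = λ_h(ℓ) Y(ẋ) for all ẋ ∈ S^{n-1} (Funk–Hecke theorem). -/

import Mathlib

open MeasureTheory Metric Filter Real
open scoped RealInnerProductSpace

noncomputable section

/-- The Euclidean Laplacian of `f` at `x`: the sum of the pure second derivatives
in the coordinate directions. -/
def lap {n : ℕ} {F : Type*} [NormedAddCommGroup F] [NormedSpace ℝ F]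
    (f : EuclideanSpace ℝ (Fin n) → F) (x : EuclideanSpace ℝ (Fin n)) : F :=
  ∑ i : Fin n, iteratedFDeriv ℝ 2 f x ![EuclideanSpace.single i 1, EuclideanSpace.single i 1]

/-- Bessel function of the first kind of order `μ`, via its power series. -/
def besselJ (μ : ℝ) (r : ℝ) : ℝ :=
  ∑' k : ℕ, ((-1 : ℝ) ^ k / ((Nat.factorial k : ℝ) * Real.Gamma ((k : ℝ) + μ + 1)))
    * (r / 2) ^ (2 * k) * (r / 2) ^ μ

/-- Bessel function of the second kind of order `μ`, as the limit of the standard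
combination `(J_α cos(απ) - J_{-α}) / sin(απ)` as `α → μ`. -/
def besselY (μ : ℝ) (r : ℝ) : ℝ :=
  limUnder (nhdsWithin μ {μ}ᶜ)
    (fun α => (besselJ α r * Real.cos (α * Real.pi) - besselJ (-α) r) / Real.sin (α * Real.pi))

/-- `P` is a harmonic polynomial in `n` variables, homogeneous of degree `ℓ`.
Its restriction to the unit sphere is a spherical harmonic of degree `ℓ`. -/
def IsHarmonicHomogeneous (n ℓ : ℕ) (P : MvPolynomial (Fin n) ℝ) : Prop :=
  P.IsHomogeneous ℓ ∧
    ∀ x : EuclideanSpace ℝ (Fin n),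
      lap (fun y => MvPolynomial.eval (fun i => y i) P) x = 0

/-- The value at `v` of the spherical harmonic determined by the polynomial `P`. -/
def sphEval {n : ℕ} (P : MvPolynomial (Fin n) ℝ) (v : EuclideanSpace ℝ (Fin n)) : ℝ :=
  MvPolynomial.eval (fun i => v i) P

/-- The (unnormalized) surface measure on the unit sphere of `ℝⁿ`. -/
def sphereMeasure (n : ℕ) : Measure (sphere (0 : EuclideanSpace ℝ (Fin n)) 1) :=
  (volume : Measure (EuclideanSpace ℝ (Fin n))).toSphere


open MvPolynomial in
theorem hasFDerivAt_sphEval {n : ℕ} (P : MvPolynomial (Fin n) ℝ)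
    (x : EuclideanSpace ℝ (Fin n)) :
    HasFDerivAt (sphEval P)
      (∑ i, sphEval (pderiv i P) x • (EuclideanSpace.proj i : EuclideanSpace ℝ (Fin n) →L[ℝ] ℝ))
      x := by
  induction P using MvPolynomial.induction_on with
  | C a =>
    have e : sphEval (C a) = fun _ : EuclideanSpace ℝ (Fin n) => a := by ext; simp [sphEval]
    rw [e]
    simpa [sphEval] using hasFDerivAt_const (𝕜 := ℝ) a x
  | add p q hp hq =>
    have h := hp.add hq
    have e : sphEval p + sphEval q = sphEval (p + q) := by ext; simp [sphEval]
    rw [e] at h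
    refine h.congr_fderiv ?_
    simp [sphEval, add_smul, Finset.sum_add_distrib]
  | mul_X p i hp =>
    have hi : HasFDerivAt (fun y : EuclideanSpace ℝ (Fin n) => y i)
        (EuclideanSpace.proj i : EuclideanSpace ℝ (Fin n) →L[ℝ] ℝ) x :=
      (EuclideanSpace.proj i : EuclideanSpace ℝ (Fin n) →L[ℝ] ℝ).hasFDerivAt
    have h := hp.mul hi
    have e : (sphEval p * fun y : EuclideanSpace ℝ (Fin n) => y i) = sphEval (p * X i) := by
      ext; simp [sphEval]
    rw [e] at h
    refine h.congr_fderiv ?_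
    ext v
    simp [sphEval, pderiv_X, Pi.single_apply, Finset.mul_sum, add_mul, Finset.sum_add_distrib,
      apply_ite, ite_mul]
    refine Finset.sum_congr rfl fun j _ => by ring

theorem fderiv_sphEval_single {n : ℕ} (P : MvPolynomial (Fin n) ℝ)
    (x : EuclideanSpace ℝ (Fin n)) (i : Fin n) :
    fderiv ℝ (sphEval P) x (EuclideanSpace.single i 1) = sphEval (MvPolynomial.pderiv i P) x := by
  rw [(hasFDerivAt_sphEval P x).fderiv]
  simp

theorem contDiff_sphEval {n : ℕ} (P : MvPolynomial (Fin n) ℝ) (m : ℕ) :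
    ContDiff ℝ m (sphEval P) := by
  induction P using MvPolynomial.induction_on with
  | C a =>
    have e : sphEval (MvPolynomial.C a) = fun _ : EuclideanSpace ℝ (Fin n) => a := by
      ext; simp [sphEval]
    rw [e]; exact contDiff_const
  | add p q hp hq =>
    have e : sphEval (p + q) = fun x => sphEval p x + sphEval q x := by ext; simp [sphEval]
    rw [e]; exact hp.add hq
  | mul_X p i hp =>
    have e : sphEval (p * MvPolynomial.X i) = fun x => sphEval p x * x i := by ext; simp [sphEval]
    rw [e]; fun_prop

theorem lap_sphEval {n : ℕ} (P : MvPolynomial (Fin n) ℝ) (x : EuclideanSpace ℝ (Fin n)) :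
    lap (sphEval P) x
      = sphEval (∑ i, MvPolynomial.pderiv i (MvPolynomial.pderiv i P)) x := by
  have hd : DifferentiableAt ℝ (fderiv ℝ (sphEval P)) x :=
    ((contDiff_sphEval P 2).fderiv_right (m := 1) (by norm_num)).differentiable (by norm_num) x
  have hsum : sphEval (∑ i, MvPolynomial.pderiv i (MvPolynomial.pderiv i P)) x
      = ∑ i, sphEval (MvPolynomial.pderiv i (MvPolynomial.pderiv i P)) x := by
    simp [sphEval]
  rw [hsum]
  refine Finset.sum_congr rfl fun i _ => ?_
  rw [iteratedFDeriv_two_apply, ← fderiv_sphEval_single]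
  have h1 : sphEval (MvPolynomial.pderiv i P)
      = fun y => fderiv ℝ (sphEval P) y (EuclideanSpace.single i 1) :=
    funext fun y => (fderiv_sphEval_single P y i).symm
  rw [h1, fderiv_clm_apply hd (differentiableAt_const _)]
  simp

theorem IsHarmonicHomogeneous.sum_pderiv_pderiv {n ℓ : ℕ} {P : MvPolynomial (Fin n) ℝ}
    (hP : IsHarmonicHomogeneous n ℓ P) :
    ∑ i, MvPolynomial.pderiv i (MvPolynomial.pderiv i P) = 0 := by
  refine MvPolynomial.funext fun x => ?_
  have := (lap_sphEval P (WithLp.toLp 2 x)).symm.trans (hP.2 _)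
  simpa [sphEval] using this

theorem abs_sphEval_le {n : ℕ} (P : MvPolynomial (Fin n) ℝ) :
    ∃ C : ℝ, ∃ m : ℕ, ∀ x : EuclideanSpace ℝ (Fin n), |sphEval P x| ≤ C * (1 + ‖x‖) ^ m := by
  induction P using MvPolynomial.induction_on with
  | C a => exact ⟨|a|, 0, fun x => by simp [sphEval]⟩
  | add p q hp hq =>
    obtain ⟨C, m, h⟩ := hp
    obtain ⟨C', m', h'⟩ := hq
    refine ⟨|C| + |C'|, m + m', fun x => ?_⟩
    have e : sphEval (p + q) x = sphEval p x + sphEval q x := by simp [sphEval]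
    have h1 : 1 ≤ 1 + ‖x‖ := by simp
    have b1 : (1 + ‖x‖) ^ m ≤ (1 + ‖x‖) ^ (m + m') := pow_le_pow_right₀ h1 (by omega)
    have b2 : (1 + ‖x‖) ^ m' ≤ (1 + ‖x‖) ^ (m + m') := pow_le_pow_right₀ h1 (by omega)
    calc |sphEval (p + q) x| ≤ |sphEval p x| + |sphEval q x| := e ▸ abs_add_le _ _
      _ ≤ |C| * (1 + ‖x‖) ^ m + |C'| * (1 + ‖x‖) ^ m' := by
        gcongr
        · exact (h x).trans (by gcongr; exact le_abs_self C)
        · exact (h' x).trans (by gcongr; exact le_abs_self C')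
      _ ≤ |C| * (1 + ‖x‖) ^ (m + m') + |C'| * (1 + ‖x‖) ^ (m + m') := by gcongr
      _ = _ := by ring
  | mul_X p i hp =>
    obtain ⟨C, m, h⟩ := hp
    refine ⟨C, m + 1, fun x => ?_⟩
    have e : sphEval (p * MvPolynomial.X i) x = sphEval p x * x i := by simp [sphEval]
    have hx : |x i| ≤ 1 + ‖x‖ := by
      have := PiLp.norm_apply_le x i
      rw [Real.norm_eq_abs] at this
      linarith
    rw [e, abs_mul, pow_succ, ← mul_assoc]
    exact mul_le_mul (h x) hx (abs_nonneg _) ((abs_nonneg _).trans (h x))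

theorem integrable_one_add_norm_pow_mul_exp (n m : ℕ)
    [Nontrivial (EuclideanSpace ℝ (Fin n))] :
    Integrable (fun x : EuclideanSpace ℝ (Fin n) => (1 + ‖x‖) ^ m * rexp (-‖x‖ ^ 2 / 2)) := by
  have key : ∀ k : ℕ,
      Integrable (fun x : EuclideanSpace ℝ (Fin n) => ‖x‖ ^ k * rexp (-‖x‖ ^ 2 / 2)) := by
    intro k
    rw [integrable_fun_norm_addHaar volume (f := fun r : ℝ => r ^ k * rexp (-r ^ 2 / 2))]
    have := integrableOn_rpow_mul_exp_neg_mul_sq (b := 1 / 2) (by norm_num)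
      (s := ((Module.finrank ℝ (EuclideanSpace ℝ (Fin n)) - 1 + k : ℕ) : ℝ))
      (by have := Nat.cast_nonneg (α := ℝ)
            (Module.finrank ℝ (EuclideanSpace ℝ (Fin n)) - 1 + k); linarith)
    refine this.congr_fun (fun r _ => ?_) measurableSet_Ioi
    simp only [Real.rpow_natCast, smul_eq_mul, pow_add]
    rw [mul_assoc]
    congr 3
    ring
  have e : (fun x : EuclideanSpace ℝ (Fin n) => (1 + ‖x‖) ^ m * rexp (-‖x‖ ^ 2 / 2))
      = fun x => ∑ k ∈ Finset.range (m + 1),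
        (m.choose k : ℝ) * (‖x‖ ^ k * rexp (-‖x‖ ^ 2 / 2)) := by
    ext x
    rw [add_comm, add_pow, Finset.sum_mul]
    refine Finset.sum_congr rfl fun k _ => ?_
    simp; ring
  rw [e]
  exact integrable_finsetSum _ fun k _ => (key k).const_mul _

theorem integrable_sphEval_mul_exp {n : ℕ} [Nontrivial (EuclideanSpace ℝ (Fin n))]
    (P : MvPolynomial (Fin n) ℝ) :
    Integrable (fun x : EuclideanSpace ℝ (Fin n) => sphEval P x * rexp (-‖x‖ ^ 2 / 2)) := by
  obtain ⟨C, m, h⟩ := abs_sphEval_le P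
  have hc : Continuous (sphEval P) := (contDiff_sphEval P 0).continuous
  refine ((integrable_one_add_norm_pow_mul_exp n m).const_mul C).mono'
    (by fun_prop) (ae_of_all _ fun x => ?_)
  rw [norm_mul, Real.norm_eq_abs, Real.norm_eq_abs, abs_of_pos (Real.exp_pos _), ← mul_assoc]
  gcongr
  exact h x

/-- The integral of a polynomial against the unnormalized Gaussian weight. -/
def gaussInt {n : ℕ} (P : MvPolynomial (Fin n) ℝ) : ℝ :=
  ∫ x : EuclideanSpace ℝ (Fin n), sphEval P x * rexp (-‖x‖ ^ 2 / 2)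

theorem gaussInt_C_mul {n : ℕ} (a : ℝ) (P : MvPolynomial (Fin n) ℝ) :
    gaussInt (MvPolynomial.C a * P) = a * gaussInt P := by
  simp only [gaussInt]
  rw [← integral_const_mul]
  simp [sphEval, mul_assoc]

section GaussInt

variable {n : ℕ} [Nontrivial (EuclideanSpace ℝ (Fin n))]

theorem gaussInt_add (P Q : MvPolynomial (Fin n) ℝ) :
    gaussInt (P + Q) = gaussInt P + gaussInt Q := by
  simp only [gaussInt]
  rw [← integral_add (integrable_sphEval_mul_exp P) (integrable_sphEval_mul_exp Q)]
  simp [sphEval, add_mul]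

theorem gaussInt_sum {ι : Type*} (s : Finset ι) (P : ι → MvPolynomial (Fin n) ℝ) :
    gaussInt (∑ i ∈ s, P i) = ∑ i ∈ s, gaussInt (P i) := by
  simp only [gaussInt]
  rw [← integral_finsetSum _ fun i _ => integrable_sphEval_mul_exp (P i)]
  simp [sphEval, Finset.sum_mul]

/-- Gaussian integration by parts. -/
theorem gaussInt_X_mul (i : Fin n) (P : MvPolynomial (Fin n) ℝ) :
    gaussInt (MvPolynomial.X i * P) = gaussInt (MvPolynomial.pderiv i P) := by
  have hg : ∀ x : EuclideanSpace ℝ (Fin n),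
      HasFDerivAt (fun y => rexp (-‖y‖ ^ 2 / 2)) (-(rexp (-‖x‖ ^ 2 / 2)) • innerSL ℝ x) x := by
    intro x
    have h := (((hasStrictFDerivAt_norm_sq x).hasFDerivAt.neg).const_mul (1 / 2)).exp
    refine (h.congr_of_eventuallyEq (.of_forall fun y => ?_)).congr_fderiv ?_
    · simp; ring
    · ext v; simp; ring_nf; simp
  have hg' : ∀ x : EuclideanSpace ℝ (Fin n),
      fderiv ℝ (fun y : EuclideanSpace ℝ (Fin n) => rexp (-‖y‖ ^ 2 / 2)) x
        (EuclideanSpace.single i 1) = -(x i * rexp (-‖x‖ ^ 2 / 2)) := by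
    intro x
    rw [(hg x).fderiv]
    simp [mul_comm, EuclideanSpace.inner_single_right]
  have e : ∀ x : EuclideanSpace ℝ (Fin n), sphEval P x * -(x i * rexp (-‖x‖ ^ 2 / 2))
      = -(sphEval (MvPolynomial.X i * P) x * rexp (-‖x‖ ^ 2 / 2)) := by
    intro x; simp [sphEval]; ring
  have key := integral_mul_fderiv_eq_neg_fderiv_mul_of_integrable
    (μ := (volume : Measure (EuclideanSpace ℝ (Fin n)))) (f := sphEval P)
    (g := fun y => rexp (-‖y‖ ^ 2 / 2)) (v := EuclideanSpace.single i 1)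
    (by simpa only [fderiv_sphEval_single] using integrable_sphEval_mul_exp _)
    (by simp only [hg', e]; exact (integrable_sphEval_mul_exp (MvPolynomial.X i * P)).neg)
    (integrable_sphEval_mul_exp P)
    (fun x _ => (hasFDerivAt_sphEval P x).differentiableAt)
    (fun x _ => (hg x).differentiableAt)
  simp only [hg', e, fderiv_sphEval_single, integral_neg, neg_inj] at key
  exact key

end GaussInt

section Algebra

open MvPolynomial

variable {n : ℕ}

/-- The linear form `y ↦ ⟨x, y⟩` as a polynomial. -/
def linForm (x : Fin n → ℝ) : MvPolynomial (Fin n) ℝ :=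
  ∑ i : Fin n, (C (x i) * X i : MvPolynomial (Fin n) ℝ)

/-- The derivative of a polynomial in the direction `x`. -/
def dirDeriv (x : Fin n → ℝ) : Derivation ℝ (MvPolynomial (Fin n) ℝ) (MvPolynomial (Fin n) ℝ) :=
  ∑ i : Fin n, x i • pderiv i

theorem dirDeriv_apply (x : Fin n → ℝ) (P : MvPolynomial (Fin n) ℝ) :
    dirDeriv x P = ∑ i, C (x i) * pderiv i P := by
  rw [dirDeriv, ← Derivation.coeFnAddMonoidHom_apply, map_sum, Finset.sum_apply]
  simp [MvPolynomial.smul_eq_C_mul]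

theorem dirDeriv_linForm (x : Fin n → ℝ) : dirDeriv x (linForm x) = C (∑ i, x i ^ 2) := by
  simp [dirDeriv_apply, linForm, pderiv_X, Pi.single_apply, pow_two]

theorem pderiv_pderiv_comm (i j : Fin n) (P : MvPolynomial (Fin n) ℝ) :
    pderiv i (pderiv j P) = pderiv j (pderiv i P) := by
  have h : ⁅(pderiv i : Derivation ℝ (MvPolynomial (Fin n) ℝ) _), pderiv j⁆ =
      (0 : Derivation ℝ (MvPolynomial (Fin n) ℝ) (MvPolynomial (Fin n) ℝ)) := by
    refine MvPolynomial.derivation_ext fun k => ?_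
    rw [Derivation.commutator_apply]
    simp [pderiv_X, Pi.single_apply, apply_ite]
  have := congrArg (fun D => D P) h
  rw [Derivation.commutator_apply] at this
  simpa [sub_eq_zero] using this

/-- Formal version of `IsHarmonicHomogeneous`. -/
def IsFormalHarmonic (ℓ : ℕ) (P : MvPolynomial (Fin n) ℝ) : Prop :=
  P.IsHomogeneous ℓ ∧ ∑ i, pderiv i (pderiv i P) = 0

theorem IsFormalHarmonic.dirDeriv {ℓ : ℕ} {P : MvPolynomial (Fin n) ℝ}
    (hP : IsFormalHarmonic ℓ P) (x : Fin n → ℝ) : IsFormalHarmonic (ℓ - 1) (dirDeriv x P) := by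
  refine ⟨?_, ?_⟩
  · rw [dirDeriv_apply]
    refine MvPolynomial.IsHomogeneous.sum _ _ _ fun i _ => ?_
    simpa using (isHomogeneous_C (Fin n) (x i)).mul (hP.1.pderiv (i := i))
  · have : ∑ i, pderiv i (pderiv i (_root_.dirDeriv x P))
        = _root_.dirDeriv x (∑ i, pderiv i (pderiv i P)) := by
      simp only [dirDeriv_apply, map_sum, Derivation.leibniz, pderiv_C, smul_eq_mul, mul_zero,
        add_zero]
      refine Finset.sum_congr rfl fun j _ => Finset.sum_congr rfl fun i _ => ?_
      rw [pderiv_pderiv_comm i j, pderiv_pderiv_comm i j]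
    rw [this, hP.2, map_zero]

theorem eval_dirDeriv_self {ℓ : ℕ} {P : MvPolynomial (Fin n) ℝ} (hP : P.IsHomogeneous ℓ)
    (x : Fin n → ℝ) : eval x (dirDeriv x P) = ℓ * eval x P := by
  have := congrArg (eval x) hP.sum_X_mul_pderiv
  simpa [dirDeriv_apply] using this

variable [Nontrivial (EuclideanSpace ℝ (Fin n))]

theorem gaussInt_linForm_mul (x : Fin n → ℝ) (P : MvPolynomial (Fin n) ℝ) :
    gaussInt (linForm x * P) = gaussInt (dirDeriv x P) := by
  simp only [linForm, Finset.sum_mul, dirDeriv_apply, gaussInt_sum, mul_assoc, gaussInt_C_mul,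
    gaussInt_X_mul]

theorem IsFormalHarmonic.gaussInt_eq_zero {ℓ : ℕ} (hℓ : ℓ ≠ 0) {P : MvPolynomial (Fin n) ℝ}
    (hP : IsFormalHarmonic ℓ P) : gaussInt P = 0 := by
  have h := congrArg gaussInt hP.1.sum_X_mul_pderiv
  simp only [gaussInt_sum, gaussInt_X_mul, nsmul_eq_mul] at h
  rw [← gaussInt_sum, hP.2, ← map_natCast (C : ℝ →+* MvPolynomial (Fin n) ℝ),
    gaussInt_C_mul] at h
  have h0 : gaussInt (0 : MvPolynomial (Fin n) ℝ) = 0 := by simp [gaussInt, sphEval]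
  simpa [h0, hℓ] using h

/-- Gaussian Funk–Hecke identity for the powers `t ^ k`. -/
theorem exists_gaussInt_linForm_pow_mul (k ℓ : ℕ) :
    ∃ c : ℝ, ∀ P : MvPolynomial (Fin n) ℝ, IsFormalHarmonic ℓ P →
      ∀ x : Fin n → ℝ, ∑ i, x i ^ 2 = 1 → gaussInt (linForm x ^ k * P) = c * eval x P := by
  induction k using Nat.strong_induction_on generalizing ℓ with
  | _ k ih =>
  match k with
  | 0 =>
    rcases eq_or_ne ℓ 0 with rfl | hℓ
    · refine ⟨gaussInt (1 : MvPolynomial (Fin n) ℝ), fun P hP x _ => ?_⟩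
      obtain ⟨a, rfl⟩ : ∃ a, P = C a :=
        ⟨_, totalDegree_eq_zero_iff_eq_C.1 (Nat.le_zero.1 hP.1.totalDegree_le)⟩
      have := gaussInt_C_mul a (1 : MvPolynomial (Fin n) ℝ)
      rw [mul_one] at this
      simp [this, mul_comm]
    · exact ⟨0, fun P hP x _ => by simp [hP.gaussInt_eq_zero hℓ]⟩
  | 1 =>
    obtain ⟨c, hc⟩ := ih 0 (by simp) (ℓ - 1)
    refine ⟨c * ℓ, fun P hP x hx => ?_⟩
    have := hc _ (hP.dirDeriv x) x hx
    rw [pow_zero, one_mul] at this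
    rw [pow_one, gaussInt_linForm_mul, this, eval_dirDeriv_self hP.1]
    ring
  | k + 2 =>
    obtain ⟨c, hc⟩ := ih (k + 1) (by simp) (ℓ - 1)
    obtain ⟨d, hd⟩ := ih k (by simp) ℓ
    refine ⟨c * ℓ + (k + 1) * d, fun P hP x hx => ?_⟩
    have e : dirDeriv x (linForm x ^ (k + 1) * P)
        = linForm x ^ (k + 1) * dirDeriv x P + C ((k : ℝ) + 1) * (linForm x ^ k * P) := by
      rw [Derivation.leibniz, Derivation.leibniz_pow, dirDeriv_linForm, hx]
      simp
      ring
    rw [pow_succ', mul_assoc, gaussInt_linForm_mul, e, gaussInt_add, gaussInt_C_mul,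
      hc _ (hP.dirDeriv x) x hx, hd P hP x hx, eval_dirDeriv_self hP.1]
    ring

end Algebra

/-- Polar coordinates for a homogeneous function against the Gaussian weight. -/
theorem exists_integral_mul_exp_eq_mul_integral_sphere (n m : ℕ)
    [Nontrivial (EuclideanSpace ℝ (Fin n))] :
    ∃ K : ℝ, K ≠ 0 ∧ ∀ G : EuclideanSpace ℝ (Fin n) → ℝ,
      (∀ r : ℝ, 0 < r → ∀ y, G (r • y) = r ^ m * G y) →
      ∫ y, G y * rexp (-‖y‖ ^ 2 / 2) = K * ∫ y, G (y : EuclideanSpace ℝ (Fin n))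
        ∂(sphereMeasure n) := by
  set d := Module.finrank ℝ (EuclideanSpace ℝ (Fin n))
  set K := ∫ r : Set.Ioi (0 : ℝ), (r : ℝ) ^ m * rexp (-(r : ℝ) ^ 2 / 2)
    ∂(Measure.volumeIoiPow (d - 1))
  have key : ∀ G : EuclideanSpace ℝ (Fin n) → ℝ,
      (∀ r : ℝ, 0 < r → ∀ y, G (r • y) = r ^ m * G y) →
      ∫ y, G y * rexp (-‖y‖ ^ 2 / 2) = K * ∫ y, G (y : EuclideanSpace ℝ (Fin n))
        ∂(sphereMeasure n) := by
    intro G hG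
    calc ∫ y, G y * rexp (-‖y‖ ^ 2 / 2)
        = ∫ y : ({(0)}ᶜ : Set (EuclideanSpace ℝ (Fin n))),
            G y * rexp (-‖(y : EuclideanSpace ℝ (Fin n))‖ ^ 2 / 2)
            ∂(Measure.comap Subtype.val volume) := by
          rw [integral_subtype_comap (measurableSet_singleton _).compl
            fun y : EuclideanSpace ℝ (Fin n) => G y * rexp (-‖y‖ ^ 2 / 2), restrict_compl_singleton]
      _ = ∫ p : sphere (0 : EuclideanSpace ℝ (Fin n)) 1 × Set.Ioi (0 : ℝ),
            G p.1 * ((p.2 : ℝ) ^ m * rexp (-(p.2 : ℝ) ^ 2 / 2))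
            ∂(volume.toSphere.prod (.volumeIoiPow (d - 1))) := by
          rw [← Measure.measurePreserving_homeomorphUnitSphereProd
            (volume : Measure (EuclideanSpace ℝ (Fin n))) |>.integral_comp
            (Homeomorph.measurableEmbedding _)]
          refine integral_congr_ae (ae_of_all _ fun y => ?_)
          have hy : 0 < ‖(y : EuclideanSpace ℝ (Fin n))‖ := norm_pos_iff.2 y.2
          simp only [homeomorphUnitSphereProd_apply_snd_coe, homeomorphUnitSphereProd_apply_fst_coe,
            hG _ (inv_pos.2 hy)]
          rw [inv_pow]
          field_simp
      _ = _ := by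
          rw [integral_prod_mul (fun y : sphere (0 : EuclideanSpace ℝ (Fin n)) 1 => G y)
            (fun r : Set.Ioi (0 : ℝ) => (r : ℝ) ^ m * rexp (-(r : ℝ) ^ 2 / 2)), mul_comm]
          rfl
  refine ⟨K, fun hK0 => ?_, key⟩
  have h := key (fun y => ‖y‖ ^ m) fun r hr y => by
    rw [norm_smul, Real.norm_of_nonneg hr.le, mul_pow]
  rw [hK0, zero_mul] at h
  obtain ⟨v, hv⟩ := exists_ne (0 : EuclideanSpace ℝ (Fin n))
  refine h.not_gt (integral_pos_of_integrable_nonneg_nonzero (x := v) (by fun_prop) ?_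
    (fun y => by positivity) (by simp [hv]))
  refine (integrable_one_add_norm_pow_mul_exp n m).mono' (by fun_prop) (ae_of_all _ fun y => ?_)
  rw [Real.norm_of_nonneg (by positivity)]
  gcongr
  simp

section FunkHecke

theorem IsHarmonicHomogeneous.isFormalHarmonic {n ℓ : ℕ} {P : MvPolynomial (Fin n) ℝ}
    (hP : IsHarmonicHomogeneous n ℓ P) : IsFormalHarmonic ℓ P :=
  ⟨hP.1, hP.sum_pderiv_pderiv⟩

variable {n : ℕ}

theorem sphEval_linForm (x y : EuclideanSpace ℝ (Fin n)) : sphEval (linForm x.ofLp) y = ⟪x, y⟫ := by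
  simp [sphEval, linForm, PiLp.inner_apply, mul_comm]

theorem sphEval_smul {m : ℕ} {P : MvPolynomial (Fin n) ℝ} (hP : P.IsHomogeneous m) (r : ℝ)
    (y : EuclideanSpace ℝ (Fin n)) : sphEval P (r • y) = r ^ m * sphEval P y := by
  simp only [sphEval, MvPolynomial.eval_eq, Finset.mul_sum]
  refine Finset.sum_congr rfl fun d hd => ?_
  have hm : ∑ i ∈ d.support, d i = m := by
    simpa [Finsupp.weight_apply, Finsupp.sum] using hP (MvPolynomial.mem_support_iff.1 hd)
  simp only [PiLp.smul_apply, smul_eq_mul, mul_pow, Finset.prod_mul_distrib,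
    Finset.prod_pow_eq_pow_sum, hm]
  ring

instance : IsFiniteMeasure (sphereMeasure n) := by unfold sphereMeasure; infer_instance

theorem integrable_sphere {F : Type*} [NormedAddCommGroup F]
    {f : sphere (0 : EuclideanSpace ℝ (Fin n)) 1 → F} (hf : Continuous f) :
    Integrable f (sphereMeasure n) :=
  hf.integrable_of_hasCompactSupport (HasCompactSupport.of_compactSpace f)

theorem continuous_sphEval (P : MvPolynomial (Fin n) ℝ) : Continuous (sphEval P) :=
  (contDiff_sphEval P 0).continuous

theorem inner_mem_Icc (x y : sphere (0 : EuclideanSpace ℝ (Fin n)) 1) :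
    ⟪(x : EuclideanSpace ℝ (Fin n)), (y : EuclideanSpace ℝ (Fin n))⟫ ∈ Set.Icc (-1 : ℝ) 1 := by
  have := abs_real_inner_le_norm (x : EuclideanSpace ℝ (Fin n)) y
  simp only [norm_eq_of_mem_sphere, mul_one] at this
  exact abs_le.1 this

theorem integrable_comp_inner_mul {F : Type*} [NormedRing F] {u : ℝ → F}
    (hu : ContinuousOn u (Set.Icc (-1) 1)) (x : sphere (0 : EuclideanSpace ℝ (Fin n)) 1)
    {g : sphere (0 : EuclideanSpace ℝ (Fin n)) 1 → F} (hg : Continuous g) :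
    Integrable (fun y : sphere (0 : EuclideanSpace ℝ (Fin n)) 1 =>
      u ⟪(x : EuclideanSpace ℝ (Fin n)), (y : EuclideanSpace ℝ (Fin n))⟫ * g y)
      (sphereMeasure n) :=
  integrable_sphere ((hu.comp_continuous (by fun_prop) fun y => inner_mem_Icc x y).mul hg)

theorem exists_integral_inner_pow_mul [Nontrivial (EuclideanSpace ℝ (Fin n))] (k ℓ : ℕ) :
    ∃ c : ℝ, ∀ P : MvPolynomial (Fin n) ℝ, IsFormalHarmonic ℓ P →
      ∀ x : sphere (0 : EuclideanSpace ℝ (Fin n)) 1,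
        ∫ y : sphere (0 : EuclideanSpace ℝ (Fin n)) 1,
          ⟪(x : EuclideanSpace ℝ (Fin n)), (y : EuclideanSpace ℝ (Fin n))⟫ ^ k * sphEval P y
          ∂(sphereMeasure n) = c * sphEval P x := by
  obtain ⟨c, hc⟩ := exists_gaussInt_linForm_pow_mul (n := n) k ℓ
  obtain ⟨K, hK, hpolar⟩ := exists_integral_mul_exp_eq_mul_integral_sphere n (k + ℓ)
  refine ⟨K⁻¹ * c, fun P hP x => ?_⟩
  have hx : ∑ i, (x : EuclideanSpace ℝ (Fin n)) i ^ 2 = 1 := by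
    rw [← EuclideanSpace.real_norm_sq_eq, norm_eq_of_mem_sphere, one_pow]
  have e : ∀ y : EuclideanSpace ℝ (Fin n),
      sphEval (linForm (x : EuclideanSpace ℝ (Fin n)).ofLp ^ k * P) y
        = ⟪(x : EuclideanSpace ℝ (Fin n)), y⟫ ^ k * sphEval P y := fun y => by
    rw [← sphEval_linForm]; simp [sphEval]
  have h1 := hpolar (sphEval (linForm (x : EuclideanSpace ℝ (Fin n)).ofLp ^ k * P))
    fun r _ y => by rw [e, e, sphEval_smul hP.1, real_inner_smul_right]; ring
  have h2 := h1.symm.trans (hc P hP _ hx)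
  simp only [e] at h2
  rw [mul_assoc, eq_inv_mul_iff_mul_eq₀ hK, h2]
  rfl

theorem exists_integral_polynomial_inner_mul [Nontrivial (EuclideanSpace ℝ (Fin n))] (ℓ : ℕ)
    (q : Polynomial ℝ) :
    ∃ c : ℝ, ∀ P : MvPolynomial (Fin n) ℝ, IsFormalHarmonic ℓ P →
      ∀ x : sphere (0 : EuclideanSpace ℝ (Fin n)) 1,
        ∫ y : sphere (0 : EuclideanSpace ℝ (Fin n)) 1,
          q.eval ⟪(x : EuclideanSpace ℝ (Fin n)), (y : EuclideanSpace ℝ (Fin n))⟫ * sphEval P y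
          ∂(sphereMeasure n) = c * sphEval P x := by
  induction q using Polynomial.induction_on' with
  | add p q hp hq =>
    obtain ⟨c, hc⟩ := hp
    obtain ⟨d, hd⟩ := hq
    refine ⟨c + d, fun P hP x => ?_⟩
    have hg : Continuous fun y : sphere (0 : EuclideanSpace ℝ (Fin n)) 1 => sphEval P y :=
      (continuous_sphEval P).comp continuous_subtype_val
    simp only [Polynomial.eval_add, add_mul]
    rw [integral_add (integrable_comp_inner_mul p.continuousOn x hg)
      (integrable_comp_inner_mul q.continuousOn x hg), hc P hP x, hd P hP x]
  | monomial k a =>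
    obtain ⟨c, hc⟩ := exists_integral_inner_pow_mul (n := n) k ℓ
    refine ⟨a * c, fun P hP x => ?_⟩
    simp only [Polynomial.eval_monomial, mul_assoc]
    rw [integral_const_mul, hc P hP x]

/-- A function that is uniformly close (relative to the weight `A`) to multiples of `s` is a
multiple of `s`. -/
theorem exists_eq_mul_of_forall_abs_sub_le {ι : Type*} {T s A : ι → ℝ} (hA : ∀ i, 0 ≤ A i)
    (h : ∀ ε > 0, ∃ c, ∀ i, |c * s i - T i| ≤ ε * A i) : ∃ c, ∀ i, T i = c * s i := by
  have cross : ∀ i j, T i * s j = T j * s i := by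
    intro i j
    have hB : 0 ≤ A i * |s j| + A j * |s i| := by have := hA i; have := hA j; positivity
    refine eq_of_abs_sub_le_all fun δ hδ => ?_
    obtain ⟨c, hc⟩ := h (δ / (A i * |s j| + A j * |s i| + 1)) (by positivity)
    calc |T i * s j - T j * s i|
        = |(c * s j - T j) * s i - (c * s i - T i) * s j| := by congr 1; ring
      _ ≤ |(c * s j - T j) * s i| + |(c * s i - T i) * s j| := by
        simpa only [Real.norm_eq_abs] using
          norm_sub_le ((c * s j - T j) * s i) ((c * s i - T i) * s j)
      _ = |c * s j - T j| * |s i| + |c * s i - T i| * |s j| := by rw [abs_mul, abs_mul]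
      _ ≤ δ / (A i * |s j| + A j * |s i| + 1) * A j * |s i|
          + δ / (A i * |s j| + A j * |s i| + 1) * A i * |s j| := by
        gcongr
        · exact hc j
        · exact hc i
      _ = δ * ((A i * |s j| + A j * |s i|) / (A i * |s j| + A j * |s i| + 1)) := by ring
      _ ≤ δ := mul_le_of_le_one_right hδ.le ((div_le_one (by positivity)).2 (by linarith))
  by_cases hs : ∃ j, s j ≠ 0
  · obtain ⟨j, hj⟩ := hs
    refine ⟨T j / s j, fun i => ?_⟩
    rw [div_mul_eq_mul_div, eq_div_iff hj, cross]
  · push Not at hs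
    refine ⟨0, fun i => ?_⟩
    have hi := hA i
    refine eq_of_abs_sub_le_all fun δ hδ => ?_
    obtain ⟨c, hc⟩ := h (δ / (A i + 1)) (by positivity)
    have := hc i
    rw [hs i, mul_zero, zero_sub, abs_neg] at this
    rw [zero_mul, sub_zero]
    refine this.trans ?_
    rw [div_mul_eq_mul_div, mul_div_assoc]
    exact mul_le_of_le_one_right hδ.le ((div_le_one (by positivity)).2 (by linarith))

/-- The Funk–Hecke theorem for real-valued kernels. -/
theorem exists_integral_comp_inner_mul_real [Nontrivial (EuclideanSpace ℝ (Fin n))] (ℓ : ℕ)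
    {u : ℝ → ℝ} (hu : ContinuousOn u (Set.Icc (-1) 1)) :
    ∃ c : ℝ, ∀ P : MvPolynomial (Fin n) ℝ, IsFormalHarmonic ℓ P →
      ∀ x : sphere (0 : EuclideanSpace ℝ (Fin n)) 1,
        ∫ y : sphere (0 : EuclideanSpace ℝ (Fin n)) 1,
          u ⟪(x : EuclideanSpace ℝ (Fin n)), (y : EuclideanSpace ℝ (Fin n))⟫ * sphEval P y
          ∂(sphereMeasure n) = c * sphEval P x := by
  have hg : ∀ P : MvPolynomial (Fin n) ℝ,
      Continuous fun y : sphere (0 : EuclideanSpace ℝ (Fin n)) 1 => sphEval P y :=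
    fun P => (continuous_sphEval P).comp continuous_subtype_val
  obtain ⟨c, hc⟩ := exists_eq_mul_of_forall_abs_sub_le
    (ι := {P : MvPolynomial (Fin n) ℝ // IsFormalHarmonic ℓ P} ×
      sphere (0 : EuclideanSpace ℝ (Fin n)) 1)
    (T := fun i => ∫ y : sphere (0 : EuclideanSpace ℝ (Fin n)) 1,
      u ⟪(i.2 : EuclideanSpace ℝ (Fin n)), (y : EuclideanSpace ℝ (Fin n))⟫ *
        sphEval i.1.1 (y : EuclideanSpace ℝ (Fin n))
      ∂(sphereMeasure n))
    (s := fun i => sphEval i.1.1 (i.2 : EuclideanSpace ℝ (Fin n)))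
    (A := fun i => ∫ y : sphere (0 : EuclideanSpace ℝ (Fin n)) 1,
      |sphEval i.1.1 (y : EuclideanSpace ℝ (Fin n))| ∂(sphereMeasure n))
    (fun i => integral_nonneg fun y => abs_nonneg _) fun ε hε => by
      obtain ⟨q, hq⟩ := exists_polynomial_near_of_continuousOn (-1) 1 u hu ε hε
      obtain ⟨c, hc⟩ := exists_integral_polynomial_inner_mul (n := n) ℓ q
      refine ⟨c, fun ⟨⟨P, hP⟩, x⟩ => ?_⟩
      dsimp only
      rw [← hc P hP x, ← integral_sub (integrable_comp_inner_mul q.continuousOn x (hg P))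
        (integrable_comp_inner_mul hu x (hg P)), ← integral_const_mul, ← Real.norm_eq_abs]
      refine norm_integral_le_of_norm_le ((integrable_sphere (hg P).abs).const_mul ε)
        (ae_of_all _ fun y => ?_)
      rw [← sub_mul, norm_mul, Real.norm_eq_abs, Real.norm_eq_abs]
      gcongr
      exact (hq _ (inner_mem_Icc x y)).le
  exact ⟨c, fun P hP x => hc (⟨P, hP⟩, x)⟩

end FunkHecke

/-- Funk–Hecke theorem: for continuous `h` on `[-1,1]` there is a scalar `λ_h(ℓ)`,
independent of the degree-`ℓ` spherical harmonic `Y`, with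
`∫_{S^{n-1}} h(⟨x,y⟩) Y(y) dσ(y) = λ_h(ℓ) Y(x)` for all `x ∈ S^{n-1}`. -/
theorem stmt3 (n ℓ : ℕ) (hn : 2 ≤ n) (h : ℝ → ℂ)
    (hh : ContinuousOn h (Set.Icc (-1 : ℝ) 1)) :
    ∃ lam : ℂ,
      ∀ P : MvPolynomial (Fin n) ℝ, IsHarmonicHomogeneous n ℓ P →
        ∀ x : sphere (0 : EuclideanSpace ℝ (Fin n)) 1,
          (∫ y : sphere (0 : EuclideanSpace ℝ (Fin n)) 1,
              h ⟪(x : EuclideanSpace ℝ (Fin n)), (y : EuclideanSpace ℝ (Fin n))⟫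
                * (sphEval P (y : EuclideanSpace ℝ (Fin n)) : ℂ) ∂(sphereMeasure n))
            = lam * (sphEval P (x : EuclideanSpace ℝ (Fin n)) : ℂ) := by
  have : Nonempty (Fin n) := ⟨⟨0, by omega⟩⟩
  have : Nontrivial (EuclideanSpace ℝ (Fin n)) := inferInstance
  obtain ⟨a, ha⟩ := exists_integral_comp_inner_mul_real (n := n) ℓ
    (Complex.continuous_re.comp_continuousOn hh)
  obtain ⟨b, hb⟩ := exists_integral_comp_inner_mul_real (n := n) ℓ
    (Complex.continuous_im.comp_continuousOn hh)
  refine ⟨⟨a, b⟩, fun P hP x => ?_⟩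
  have hg : Continuous fun y : sphere (0 : EuclideanSpace ℝ (Fin n)) 1 => (sphEval P y : ℂ) :=
    Complex.continuous_ofReal.comp ((continuous_sphEval P).comp continuous_subtype_val)
  have hi := integrable_comp_inner_mul hh x hg
  have hre := ha P hP.isFormalHarmonic x
  have him := hb P hP.isFormalHarmonic x
  apply Complex.ext
  · rw [← Complex.reCLM_apply, ← Complex.reCLM.integral_comp_comm hi]
    simpa using hre
  · rw [← Complex.imCLM_apply, ← Complex.imCLM.integral_comp_comm hi]
    simpa using him

end
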